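/- arXiv:2508.07889 — 4 statements merged into one kernel-verified Lean document; each statement's English description precedes it below -/
import Mathlib

section
/- Let 𝔤 be a real Lie algebra with a complex structure J such that J𝔤¹ ⊆ 𝔷. Then for all X, Y, Z ∈ 𝔤 one has [[X,Y],Z] = −J[[X,Y],JZ]. Consequently [𝔤,𝔤¹] ⊆ 𝔷 (so 𝔤 is nilpotent of step at most 3) and [𝔤¹,𝔤¹] = 0. -/
noncomputable section

/-- The commutator ideal `𝔤¹ = [𝔤,𝔤]` of a real Lie algebra, as a submodule:
the span of all brackets. -/
def commIdeal (L : Type*) [LieRing L] [LieAlgebra ℝ L] : Submodule ℝ L :=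
  Submodule.span ℝ {z : L | ∃ x y : L, ⁅x, y⁆ = z}

/-- The center `𝔷` of a real Lie algebra, as a submodule. -/
def centerSub (L : Type*) [LieRing L] [LieAlgebra ℝ L] : Submodule ℝ L where
  carrier := {z : L | ∀ x : L, ⁅z, x⁆ = 0}
  add_mem' := by
    intro a b ha hb x
    rw [add_lie, ha x, hb x, add_zero]
  zero_mem' := fun x => zero_lie x
  smul_mem' := by
    intro c a ha x
    rw [smul_lie, ha x, smul_zero]

/-- The Nijenhuis tensor of an endomorphism `J` of a Lie algebra. -/
def nijenhuis {L : Type*} [LieRing L] [LieAlgebra ℝ L] (J : Module.End ℝ L) (X Y : L) : L :=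
  ⁅X, Y⁆ + J (⁅J X, Y⁆ + ⁅X, J Y⁆) - ⁅J X, J Y⁆

/-- A complex structure on a real Lie algebra: `J² = -id` and `N_J ≡ 0`. -/
structure IsComplexStructure {L : Type*} [LieRing L] [LieAlgebra ℝ L]
    (J : Module.End ℝ L) : Prop where
  sq : ∀ X : L, J (J X) = -X
  integrable : ∀ X Y : L, nijenhuis J X Y = 0

/-- A hypercomplex structure `(J₁,J₂,J₃)` on a real Lie algebra. -/
structure IsHypercomplex {L : Type*} [LieRing L] [LieAlgebra ℝ L]
    (J1 J2 J3 : Module.End ℝ L) : Prop where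
  c1 : IsComplexStructure J1
  c2 : IsComplexStructure J2
  c3 : IsComplexStructure J3
  q12 : ∀ X : L, J1 (J2 X) = J3 X
  q21 : ∀ X : L, J2 (J1 X) = -J3 X

/-- The Obata connection `∇_X Y` of a hypercomplex Lie algebra. -/
def obata {L : Type*} [LieRing L] [LieAlgebra ℝ L] (J1 J2 J3 : Module.End ℝ L)
    (X Y : L) : L :=
  (1/2 : ℝ) • (⁅X, Y⁆ + J1 ⁅J1 X, Y⁆ - J2 ⁅X, J2 Y⁆ + J3 ⁅J1 X, J2 Y⁆)

/-- The curvature tensor `R(X,Y)Z` of the Obata connection. -/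
def obataCurv {L : Type*} [LieRing L] [LieAlgebra ℝ L] (J1 J2 J3 : Module.End ℝ L)
    (X Y Z : L) : L :=
  obata J1 J2 J3 X (obata J1 J2 J3 Y Z) - obata J1 J2 J3 Y (obata J1 J2 J3 X Z)
    - obata J1 J2 J3 ⁅X, Y⁆ Z

section CommutatorIdeal

variable {L : Type*} [LieRing L] [LieAlgebra ℝ L]

lemma lie_mem_commIdeal (X Y : L) : ⁅X, Y⁆ ∈ commIdeal L :=
  Submodule.subset_span ⟨X, Y, rfl⟩

variable {J : Module.End ℝ L}

lemma IsComplexStructure.lie_eq_neg_of_mem_commIdeal (hJ : IsComplexStructure J)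
    (hc : (commIdeal L).map J ≤ centerSub L) {W : L} (hW : W ∈ commIdeal L) (Z : L) :
    ⁅W, Z⁆ = -(J ⁅W, J Z⁆) := by
  have hcentral : ∀ x : L, ⁅J W, x⁆ = 0 := hc (Submodule.mem_map_of_mem hW)
  have hN := hJ.integrable W Z
  rw [nijenhuis, hcentral, hcentral, zero_add, sub_zero] at hN
  exact eq_neg_of_add_eq_zero_left hN

lemma IsComplexStructure.lie_mem_centerSub_of_mem_commIdeal (hJ : IsComplexStructure J)
    (hc : (commIdeal L).map J ≤ centerSub L) {W : L} (hW : W ∈ commIdeal L) (Z : L) :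
    ⁅W, Z⁆ ∈ centerSub L := by
  rw [hJ.lie_eq_neg_of_mem_commIdeal hc hW Z]
  exact neg_mem (hc (Submodule.mem_map_of_mem (lie_mem_commIdeal W (J Z))))

lemma IsComplexStructure.lie_eq_zero_of_mem_commIdeal (hJ : IsComplexStructure J)
    (hc : (commIdeal L).map J ≤ centerSub L) {X Y : L} (hX : X ∈ commIdeal L)
    (hY : Y ∈ commIdeal L) : ⁅X, Y⁆ = 0 := by
  have hcentral (A B : L) : ⁅⁅X, A⁆, B⁆ = 0 :=
    hJ.lie_mem_centerSub_of_mem_commIdeal hc hX A B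
  induction hY using Submodule.span_induction with
  | mem Y hY =>
    obtain ⟨A, B, rfl⟩ := hY
    rw [leibniz_lie, hcentral, ← lie_skew, hcentral, neg_zero, zero_add]
  | zero => exact lie_zero X
  | add A B _ _ hA hB => rw [lie_add, hA, hB, add_zero]
  | smul c A _ hA => rw [lie_smul, hA, smul_zero]

end CommutatorIdeal

/-- If `J` is a complex structure on a real Lie algebra `𝔤` with `J𝔤¹ ⊆ 𝔷`, then
`[[X,Y],Z] = −J[[X,Y],JZ]` for all `X,Y,Z`; consequently `[𝔤,𝔤¹] ⊆ 𝔷` (so `𝔤` is nilpotent of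
step at most 3) and `[𝔤¹,𝔤¹] = 0`. -/
theorem stmt_4 {L : Type*} [LieRing L] [LieAlgebra ℝ L] [FiniteDimensional ℝ L]
    (J : Module.End ℝ L) (hJ : IsComplexStructure J)
    (hc : (commIdeal L).map J ≤ centerSub L) :
    (∀ X Y Z : L, ⁅⁅X, Y⁆, Z⁆ = -(J ⁅⁅X, Y⁆, J Z⁆)) ∧
    (∀ X : L, ∀ Y ∈ commIdeal L, ⁅X, Y⁆ ∈ centerSub L) ∧
    (∀ A B C D : L, ⁅⁅⁅A, B⁆, C⁆, D⁆ = 0) ∧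
    (∀ X ∈ commIdeal L, ∀ Y ∈ commIdeal L, ⁅X, Y⁆ = 0) := by
  refine ⟨fun X Y Z => hJ.lie_eq_neg_of_mem_commIdeal hc (lie_mem_commIdeal X Y) Z,
    fun X Y hY => ?_,
    fun A B C D => hJ.lie_mem_centerSub_of_mem_commIdeal hc (lie_mem_commIdeal A B) C D,
    fun X hX Y hY => hJ.lie_eq_zero_of_mem_commIdeal hc hX hY⟩
  rw [← lie_skew]
  exact neg_mem (hJ.lie_mem_centerSub_of_mem_commIdeal hc hY X)
end
end

section
/- Let (𝔤, J₁, J₂, J₃) be a 2-step nilpotent hypercomplex real Lie algebra. Then 𝔤₂^ℍ ⊆ 𝔤¹ + J₁𝔤¹ and 𝔤₃^ℍ = 0; that is, (𝔤, J₁, J₂, J₃) is ℍ-solvable with ℍ-solvability step at most 3. In particular, if 𝔤 ≠ 0 then 𝔤₁^ℍ = 𝔤¹ + J₁𝔤¹ + J₂𝔤¹ + J₃𝔤¹ is a proper ideal of 𝔤. -/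
noncomputable section

/-- The `ℍ`-series `𝔤_k^ℍ`: `𝔤₀^ℍ = 𝔤` and
`𝔤_k^ℍ = [𝔤_{k-1}^ℍ,𝔤_{k-1}^ℍ] + J₁[⋯] + J₂[⋯] + J₃[⋯]`. -/
def gH {L : Type*} [LieRing L] [LieAlgebra ℝ L] (J1 J2 J3 : Module.End ℝ L) :
    ℕ → Submodule ℝ L
  | 0 => ⊤
  | (k + 1) =>
      let B := Submodule.span ℝ
        {z : L | ∃ x ∈ gH J1 J2 J3 k, ∃ y ∈ gH J1 J2 J3 k, ⁅x, y⁆ = z}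
      B ⊔ B.map J1 ⊔ B.map J2 ⊔ B.map J3

section HypercomplexLemmas

variable {L : Type*} [LieRing L] [LieAlgebra ℝ L] {J1 J2 J3 : Module.End ℝ L}

theorem lie_mem_commIdeal_s12 (x y : L) : ⁅x, y⁆ ∈ commIdeal L :=
  Submodule.subset_span ⟨x, y, rfl⟩

theorem lie_eq_zero_of_mem_centerSub {z : L} (hz : z ∈ centerSub L) (x : L) : ⁅z, x⁆ = 0 :=
  hz x

theorem lie_eq_zero_of_mem_centerSub_right {z : L} (hz : z ∈ centerSub L) (x : L) :
    ⁅x, z⁆ = 0 := by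
  rw [← lie_skew, hz x, neg_zero]

/-- If `z` is central, then `ad (J z)` commutes with the complex structure `J`. -/
theorem IsComplexStructure.lie_apply_apply {J : Module.End ℝ L} (hJ : IsComplexStructure J)
    {z : L} (hz : z ∈ centerSub L) (y : L) : ⁅J z, J y⁆ = J ⁅J z, y⁆ := by
  have h := hJ.integrable z y
  simp only [nijenhuis, lie_eq_zero_of_mem_centerSub hz, add_zero, zero_add] at h
  exact (sub_eq_zero.mp h).symm

theorem IsComplexStructure.lie_apply_apply_eq_zero {J : Module.End ℝ L}
    (hJ : IsComplexStructure J) {z w : L} (hz : z ∈ centerSub L) (hw : w ∈ centerSub L) :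
    ⁅J z, J w⁆ = 0 := by
  rw [hJ.lie_apply_apply hz, lie_eq_zero_of_mem_centerSub_right hw, map_zero]

namespace IsHypercomplex

theorem lie_J1_J3 (hH : IsHypercomplex J1 J2 J3) {z : L} (hz : z ∈ centerSub L) (w : L) :
    ⁅J1 z, J3 w⁆ = J1 ⁅J1 z, J2 w⁆ := by
  rw [← hH.q12, hH.c1.lie_apply_apply hz]

theorem lie_J2_J3 (hH : IsHypercomplex J1 J2 J3) {z : L} (hz : z ∈ centerSub L) (w : L) :
    ⁅J2 z, J3 w⁆ = J2 ⁅J1 w, J2 z⁆ := by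
  have h : J3 w = -J2 (J1 w) := by rw [hH.q21, neg_neg]
  rw [h, lie_neg, hH.c2.lie_apply_apply hz, ← lie_skew, map_neg, neg_neg]

end IsHypercomplex

theorem mem_gH_succ_of_lie (k : ℕ) {x y : L} (hx : x ∈ gH J1 J2 J3 k)
    (hy : y ∈ gH J1 J2 J3 k) : ⁅x, y⁆ ∈ gH J1 J2 J3 (k + 1) :=
  Submodule.mem_sup_left <| Submodule.mem_sup_left <| Submodule.mem_sup_left <|
    Submodule.subset_span ⟨x, hx, y, hy, rfl⟩

theorem gH_succ_le {k : ℕ} {T : Submodule ℝ L} (h1 : T ≤ T.comap J1) (h2 : T ≤ T.comap J2)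
    (h3 : T ≤ T.comap J3)
    (h : ∀ x ∈ gH J1 J2 J3 k, ∀ y ∈ gH J1 J2 J3 k, ⁅x, y⁆ ∈ T) :
    gH J1 J2 J3 (k + 1) ≤ T := by
  have hB : Submodule.span ℝ
      {z : L | ∃ x ∈ gH J1 J2 J3 k, ∃ y ∈ gH J1 J2 J3 k, ⁅x, y⁆ = z} ≤ T := by
    rw [Submodule.span_le]
    rintro _ ⟨x, hx, y, hy, rfl⟩
    exact h x hx y hy
  exact sup_le (sup_le (sup_le hB (Submodule.map_le_iff_le_comap.mpr (hB.trans h1)))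
    (Submodule.map_le_iff_le_comap.mpr (hB.trans h2)))
    (Submodule.map_le_iff_le_comap.mpr (hB.trans h3))

theorem gH_one : gH J1 J2 J3 1 =
    commIdeal L ⊔ (commIdeal L).map J1 ⊔ (commIdeal L).map J2 ⊔ (commIdeal L).map J3 := by
  simp [gH, commIdeal]

/-- The largest subspace of `S` stable under a hypercomplex structure. -/
def quaternionicCore (J1 J2 J3 : Module.End ℝ L) (S : Submodule ℝ L) : Submodule ℝ L :=
  S ⊓ S.comap J1 ⊓ S.comap J2 ⊓ S.comap J3

theorem mem_quaternionicCore {S : Submodule ℝ L} {x : L} :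
    x ∈ quaternionicCore J1 J2 J3 S ↔ x ∈ S ∧ J1 x ∈ S ∧ J2 x ∈ S ∧ J3 x ∈ S := by
  simp [quaternionicCore, and_assoc]

namespace IsHypercomplex

theorem J1_mem_quaternionicCore (hH : IsHypercomplex J1 J2 J3) {S : Submodule ℝ L} {x : L}
    (hx : x ∈ quaternionicCore J1 J2 J3 S) : J1 x ∈ quaternionicCore J1 J2 J3 S := by
  rw [mem_quaternionicCore] at hx ⊢
  obtain ⟨h0, h1, h2, h3⟩ := hx
  have e : J3 (J1 x) = J2 x := by
    rw [← neg_neg (J3 (J1 x)), ← hH.q21, hH.c1.sq, map_neg, neg_neg]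
  exact ⟨h1, by rw [hH.c1.sq]; exact S.neg_mem h0, by rw [hH.q21]; exact S.neg_mem h3,
    e ▸ h2⟩

theorem J2_mem_quaternionicCore (hH : IsHypercomplex J1 J2 J3) {S : Submodule ℝ L} {x : L}
    (hx : x ∈ quaternionicCore J1 J2 J3 S) : J2 x ∈ quaternionicCore J1 J2 J3 S := by
  rw [mem_quaternionicCore] at hx ⊢
  obtain ⟨h0, h1, h2, h3⟩ := hx
  have e : J3 (J2 x) = -J1 x := by
    rw [← hH.q12, hH.c2.sq, map_neg]
  exact ⟨h2, by rwa [hH.q12], by rw [hH.c2.sq]; exact S.neg_mem h0,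
    by rw [e]; exact S.neg_mem h1⟩

theorem J3_mem_quaternionicCore (hH : IsHypercomplex J1 J2 J3) {S : Submodule ℝ L} {x : L}
    (hx : x ∈ quaternionicCore J1 J2 J3 S) : J3 x ∈ quaternionicCore J1 J2 J3 S := by
  rw [← hH.q12]
  exact hH.J1_mem_quaternionicCore (hH.J2_mem_quaternionicCore hx)

theorem lie_J1_J2_mem_quaternionicCore (hH : IsHypercomplex J1 J2 J3) {z w : L}
    (hz : z ∈ centerSub L) (hw : w ∈ centerSub L) :
    ⁅J1 z, J2 w⁆ ∈ quaternionicCore J1 J2 J3 (commIdeal L ⊔ (commIdeal L).map J1) := by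
  have h2 : J2 ⁅J1 z, J2 w⁆ ∈ commIdeal L := by
    rw [← hH.lie_J2_J3 hw]
    exact lie_mem_commIdeal_s12 _ _
  rw [mem_quaternionicCore, ← hH.lie_J1_J3 hz, ← hH.q12 ⁅J1 z, J2 w⁆]
  exact ⟨Submodule.mem_sup_left (lie_mem_commIdeal_s12 _ _),
    Submodule.mem_sup_left (lie_mem_commIdeal_s12 _ _), Submodule.mem_sup_left h2,
    Submodule.mem_sup_right (Submodule.mem_map_of_mem h2)⟩

theorem lie_mem_quaternionicCore (hH : IsHypercomplex J1 J2 J3)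
    (hc : commIdeal L ≤ centerSub L) {a b : L} (ha : a ∈ gH J1 J2 J3 1)
    (hb : b ∈ gH J1 J2 J3 1) :
    ⁅a, b⁆ ∈ quaternionicCore J1 J2 J3 (commIdeal L ⊔ (commIdeal L).map J1) := by
  have decomp : ∀ c ∈ gH J1 J2 J3 1, ∃ z0 ∈ centerSub L, ∃ z1 ∈ centerSub L,
      ∃ z2 ∈ centerSub L, ∃ z3 ∈ centerSub L, z0 + J1 z1 + J2 z2 + J3 z3 = c := by
    intro c h
    rw [gH_one] at h
    obtain ⟨_, hsum2, _, ⟨z3, h3, rfl⟩, rfl⟩ := Submodule.mem_sup.mp h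
    obtain ⟨_, hsum1, _, ⟨z2, h2, rfl⟩, rfl⟩ := Submodule.mem_sup.mp hsum2
    obtain ⟨z0, h0, _, ⟨z1, h1, rfl⟩, rfl⟩ := Submodule.mem_sup.mp hsum1
    exact ⟨z0, hc h0, z1, hc h1, z2, hc h2, z3, hc h3, rfl⟩
  obtain ⟨z0, hz0, z1, hz1, z2, hz2, z3, hz3, rfl⟩ := decomp a ha
  obtain ⟨w0, hw0, w1, hw1, w2, hw2, w3, hw3, rfl⟩ := decomp b hb
  set W := quaternionicCore J1 J2 J3 (commIdeal L ⊔ (commIdeal L).map J1)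
  have m12 : ∀ z ∈ centerSub L, ∀ w ∈ centerSub L, ⁅J1 z, J2 w⁆ ∈ W :=
    fun z hz w hw => hH.lie_J1_J2_mem_quaternionicCore hz hw
  have m13 : ∀ z ∈ centerSub L, ∀ w ∈ centerSub L, ⁅J1 z, J3 w⁆ ∈ W := by
    intro z hz w hw
    rw [hH.lie_J1_J3 hz]
    exact hH.J1_mem_quaternionicCore (m12 z hz w hw)
  have m23 : ∀ z ∈ centerSub L, ∀ w ∈ centerSub L, ⁅J2 z, J3 w⁆ ∈ W := by
    intro z hz w hw
    rw [hH.lie_J2_J3 hz]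
    exact hH.J2_mem_quaternionicCore (m12 w hw z hz)
  have swap : ∀ x y : L, ⁅x, y⁆ ∈ W → ⁅y, x⁆ ∈ W := by
    intro x y h
    rw [← lie_skew]
    exact W.neg_mem h
  simp only [add_lie, lie_add, lie_eq_zero_of_mem_centerSub hz0,
    lie_eq_zero_of_mem_centerSub_right hw0, hH.c1.lie_apply_apply_eq_zero hz1 hw1,
    hH.c2.lie_apply_apply_eq_zero hz2 hw2, hH.c3.lie_apply_apply_eq_zero hz3 hw3,
    add_zero, zero_add]
  have t12 := m12 z1 hz1 w2 hw2
  have t13 := m13 z1 hz1 w3 hw3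
  have t23 := m23 z2 hz2 w3 hw3
  have t21 := swap _ _ (m12 w1 hw1 z2 hz2)
  have t31 := swap _ _ (m13 w1 hw1 z3 hz3)
  have t32 := swap _ _ (m23 w2 hw2 z3 hz3)
  repeat' first | assumption | apply W.add_mem

theorem gH_two_le (hH : IsHypercomplex J1 J2 J3) (hc : commIdeal L ≤ centerSub L) :
    gH J1 J2 J3 2 ≤ commIdeal L ⊔ (commIdeal L).map J1 :=
  (gH_succ_le (fun _ hx => hH.J1_mem_quaternionicCore hx)
    (fun _ hx => hH.J2_mem_quaternionicCore hx) (fun _ hx => hH.J3_mem_quaternionicCore hx)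
    (fun _ ha _ hb => hH.lie_mem_quaternionicCore hc ha hb)).trans
    fun _ hx => (mem_quaternionicCore.mp hx).1

theorem gH_three_eq_bot (hH : IsHypercomplex J1 J2 J3) (hc : commIdeal L ≤ centerSub L) :
    gH J1 J2 J3 3 = ⊥ := by
  refine le_bot_iff.mp (gH_succ_le bot_le bot_le bot_le fun a ha b hb => ?_)
  obtain ⟨z, hz, _, ⟨z', hz', rfl⟩, rfl⟩ := Submodule.mem_sup.mp (hH.gH_two_le hc ha)
  obtain ⟨w, hw, _, ⟨w', hw', rfl⟩, rfl⟩ := Submodule.mem_sup.mp (hH.gH_two_le hc hb)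
  rw [Submodule.mem_bot, add_lie, lie_add, lie_add, lie_eq_zero_of_mem_centerSub (hc hz),
    lie_eq_zero_of_mem_centerSub (hc hz), lie_eq_zero_of_mem_centerSub_right (hc hw),
    hH.c1.lie_apply_apply_eq_zero (hc hz') (hc hw'), add_zero, add_zero]

end IsHypercomplex

theorem gH_eq_top_of_gH_one_eq_top (h : gH J1 J2 J3 1 = ⊤) (k : ℕ) : gH J1 J2 J3 k = ⊤ := by
  induction k with
  | zero => rfl
  | succ k ih =>
    rw [← h]
    simp only [gH, ih]

end HypercomplexLemmas

/-- A 2-step nilpotent hypercomplex Lie algebra is ℍ-solvable with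
ℍ-solvability step at most 3: `𝔤₂^ℍ ⊆ 𝔤¹ + J₁𝔤¹` and `𝔤₃^ℍ = 0`.  In particular
`𝔤₁^ℍ = 𝔤¹ + J₁𝔤¹ + J₂𝔤¹ + J₃𝔤¹`, and if `𝔤 ≠ 0` it is a proper ideal of `𝔤`. -/
theorem stmt_12 {L : Type*} [LieRing L] [LieAlgebra ℝ L] [FiniteDimensional ℝ L]
    (J1 J2 J3 : Module.End ℝ L) (hH : IsHypercomplex J1 J2 J3)
    (h2 : commIdeal L ≤ centerSub L) :
    gH J1 J2 J3 2 ≤ commIdeal L ⊔ (commIdeal L).map J1 ∧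
    gH J1 J2 J3 3 = ⊥ ∧
    gH J1 J2 J3 1 =
      commIdeal L ⊔ (commIdeal L).map J1 ⊔ (commIdeal L).map J2 ⊔ (commIdeal L).map J3 ∧
    (∀ a ∈ gH J1 J2 J3 1, ∀ x : L, ⁅a, x⁆ ∈ gH J1 J2 J3 1) ∧
    ((∃ x : L, x ≠ 0) → gH J1 J2 J3 1 ≠ ⊤) := by
  refine ⟨hH.gH_two_le h2, hH.gH_three_eq_bot h2, gH_one, fun a _ x => ?_, ?_⟩
  · exact mem_gH_succ_of_lie 0 Submodule.mem_top Submodule.mem_top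
  · rintro ⟨x, hx⟩ htop
    have hbot : (⊤ : Submodule ℝ L) = ⊥ :=
      (gH_eq_top_of_gH_one_eq_top htop 3).symm.trans (hH.gH_three_eq_bot h2)
    exact hx ((Submodule.mem_bot ℝ).mp (hbot ▸ Submodule.mem_top))
end
end

section
/- Let (𝔤, J₁, J₂, J₃) be a 2-step nilpotent hypercomplex real Lie algebra and set 𝔥 = (𝔤¹ ∩ J₂𝔤¹) + (J₁𝔤¹ ∩ J₃𝔤¹). Then the curvature tensor of the Obata connection satisfies R(X,Y)Z ∈ 𝔥 for all X, Y, Z ∈ 𝔤. Moreover, 𝔥 is invariant under J₁, J₂ and J₃, and 𝔥 ⊆ 𝔤₁^ℍ = 𝔤¹ + J₁𝔤¹ + J₂𝔤¹ + J₃𝔤¹. -/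
noncomputable section

/-- The subspace `𝔥 = (𝔤¹ ∩ J₂𝔤¹) + (J₁𝔤¹ ∩ J₃𝔤¹)`. -/
def hSub {L : Type*} [LieRing L] [LieAlgebra ℝ L] (J1 J2 J3 : Module.End ℝ L) :
    Submodule ℝ L :=
  (commIdeal L ⊓ (commIdeal L).map J2) ⊔ ((commIdeal L).map J1 ⊓ (commIdeal L).map J3)

namespace IsHypercomplex

variable {L : Type*} [LieRing L] [LieAlgebra ℝ L] {J1 J2 J3 : Module.End ℝ L}

lemma q13 (hH : IsHypercomplex J1 J2 J3) (X : L) : J1 (J3 X) = -J2 X := by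
  rw [← hH.q12, hH.c1.sq]

lemma q23 (hH : IsHypercomplex J1 J2 J3) (X : L) : J2 (J3 X) = J1 X := by
  rw [← neg_neg (J3 X), ← hH.q21, map_neg, hH.c2.sq, neg_neg]

lemma q31 (hH : IsHypercomplex J1 J2 J3) (X : L) : J3 (J1 X) = J2 X := by
  rw [← hH.q12, hH.q21, map_neg, hH.q13, neg_neg]

/-- The Obata connection commutes with `J₂`. -/
lemma obata_J2 (hH : IsHypercomplex J1 J2 J3) (X Y : L) :
    obata J1 J2 J3 X (J2 Y) = J2 (obata J1 J2 J3 X Y) := by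
  simp only [obata, map_smul, map_add, map_sub, map_neg, lie_neg, hH.c2.sq, hH.q21, hH.q23]
  module

/-- The Obata connection commutes with `J₁`. -/
lemma obata_J1 (hH : IsHypercomplex J1 J2 J3) (X Y : L) :
    obata J1 J2 J3 X (J1 Y) = J1 (obata J1 J2 J3 X Y) := by
  have h1 := congrArg J1 (hH.c1.integrable X Y)
  have h2 := congrArg J3 (hH.c1.integrable X (J2 Y))
  simp only [nijenhuis, map_add, map_sub, map_zero, hH.c1.sq, hH.q12, hH.q31] at h1 h2
  simp only [obata, map_smul, map_add, map_sub, map_neg, lie_neg, hH.c1.sq, hH.q12, hH.q21,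
    hH.q13]
  linear_combination (norm := module) (-(1 / 2) : ℝ) • h1 + (1 / 2 : ℝ) • h2

/-- The Obata connection commutes with `J₃`. -/
lemma obata_J3 (hH : IsHypercomplex J1 J2 J3) (X Y : L) :
    obata J1 J2 J3 X (J3 Y) = J3 (obata J1 J2 J3 X Y) := by
  rw [← hH.q12, hH.obata_J1, hH.obata_J2, hH.q12]

/-- The Obata connection is torsion-free. -/
lemma obata_sub_obata (hH : IsHypercomplex J1 J2 J3) (X Y : L) :
    obata J1 J2 J3 X Y - obata J1 J2 J3 Y X = ⁅X, Y⁆ := by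
  have h1 := hH.c1.integrable X Y
  have h2 := hH.c2.integrable X Y
  have h3 := hH.c3.integrable (J1 X) (J1 Y)
  simp only [nijenhuis, map_add, hH.q31] at h1 h2 h3
  simp only [obata]
  rw [← lie_skew X Y, ← lie_skew X (J1 Y), ← lie_skew (J2 X) Y,
    ← lie_skew (J2 X) (J1 Y)] at *
  simp only [map_neg] at *
  linear_combination (norm := module) (1 / 2 : ℝ) • h1 - (1 / 2 : ℝ) • h2 + (1 / 2 : ℝ) • h3

lemma hSub_map_J1 (hH : IsHypercomplex J1 J2 J3) {x : L} (hx : x ∈ hSub J1 J2 J3) :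
    J1 x ∈ hSub J1 J2 J3 := by
  obtain ⟨_, ⟨ha, ⟨b, hb, rfl⟩⟩, _, ⟨⟨c, hc, rfl⟩, ⟨d, hd, hdc⟩⟩, rfl⟩ := Submodule.mem_sup.1 hx
  rw [map_add, add_comm]
  refine Submodule.add_mem_sup ⟨?_, ⟨-d, neg_mem hd, ?_⟩⟩ ⟨⟨_, ha, rfl⟩, ⟨b, hb, ?_⟩⟩
  · rw [hH.c1.sq]; exact neg_mem hc
  · rw [← hdc, hH.q13, map_neg]
  · rw [hH.q12]

lemma hSub_map_J2 (hH : IsHypercomplex J1 J2 J3) {x : L} (hx : x ∈ hSub J1 J2 J3) :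
    J2 x ∈ hSub J1 J2 J3 := by
  obtain ⟨_, ⟨ha, ⟨b, hb, rfl⟩⟩, _, ⟨⟨c, hc, rfl⟩, ⟨d, hd, hdc⟩⟩, rfl⟩ := Submodule.mem_sup.1 hx
  rw [map_add]
  refine Submodule.add_mem_sup ⟨?_, ⟨_, ha, rfl⟩⟩ ⟨⟨d, hd, ?_⟩, ⟨-c, neg_mem hc, ?_⟩⟩
  · rw [hH.c2.sq]; exact neg_mem hb
  · rw [← hdc, hH.q23]
  · rw [hH.q21, map_neg]

lemma hSub_map_J3 (hH : IsHypercomplex J1 J2 J3) {x : L} (hx : x ∈ hSub J1 J2 J3) :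
    J3 x ∈ hSub J1 J2 J3 := by
  rw [← hH.q12]
  exact hH.hSub_map_J1 (hH.hSub_map_J2 hx)

lemma lie_mem_commIdeal (x y : L) : ⁅x, y⁆ ∈ commIdeal L :=
  Submodule.subset_span ⟨x, y, rfl⟩

/-- The Obata derivative of a central element lies in `𝔥`. -/
lemma obata_mem_hSub_of_mem_center (hH : IsHypercomplex J1 J2 J3) (X : L) {a : L}
    (ha : a ∈ centerSub L) : obata J1 J2 J3 X a ∈ hSub J1 J2 J3 := by
  have hc : ∀ x : L, ⁅x, a⁆ = 0 := fun x => by rw [← lie_skew, ha x, neg_zero]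
  have h2 : ∀ x : L, J2 ⁅x, J2 a⁆ = ⁅J2 x, J2 a⁆ := fun x => by
    have h := hH.c2.integrable x a
    rw [nijenhuis, hc, hc, zero_add, zero_add] at h
    exact sub_eq_zero.1 h
  have e : obata J1 J2 J3 X a
      = (1 / 2 : ℝ) • (-⁅J2 X, J2 a⁆) + (1 / 2 : ℝ) • J3 ⁅J1 X, J2 a⁆ := by
    rw [obata, hc, hc, h2, map_zero]
    module
  rw [e]
  refine Submodule.add_mem_sup (Submodule.smul_mem _ _ (neg_mem ?_)) (Submodule.smul_mem _ _ ?_)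
  · exact ⟨lie_mem_commIdeal _ _, ⟨_, lie_mem_commIdeal _ _, h2 X⟩⟩
  · refine ⟨⟨_, lie_mem_commIdeal (J2 (J1 X)) (J2 a), ?_⟩, ⟨_, lie_mem_commIdeal _ _, rfl⟩⟩
    rw [← h2, hH.q12]

/-- On a 2-step nilpotent Lie algebra, second Obata derivatives lie in `𝔥`. -/
lemma obata_obata_mem_hSub (hH : IsHypercomplex J1 J2 J3) (h2 : commIdeal L ≤ centerSub L)
    (X Y Z : L) : obata J1 J2 J3 X (obata J1 J2 J3 Y Z) ∈ hSub J1 J2 J3 := by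
  have key (x y : L) : obata J1 J2 J3 X ⁅x, y⁆ ∈ hSub J1 J2 J3 :=
    hH.obata_mem_hSub_of_mem_center X (h2 (lie_mem_commIdeal x y))
  have e (a b c d : L) : obata J1 J2 J3 X ((1 / 2 : ℝ) • (a + J1 b - J2 c + J3 d))
      = (1 / 2 : ℝ) • (obata J1 J2 J3 X a + J1 (obata J1 J2 J3 X b)
        - J2 (obata J1 J2 J3 X c) + J3 (obata J1 J2 J3 X d)) := by
    rw [← hH.obata_J1, ← hH.obata_J2, ← hH.obata_J3]
    simp only [obata, map_smul, map_add, map_sub, lie_smul, lie_add, lie_sub]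
    module
  rw [obata.eq_def J1 J2 J3 Y Z, e]
  exact Submodule.smul_mem _ _ (add_mem (sub_mem (add_mem (key _ _) (hH.hSub_map_J1 (key _ _)))
    (hH.hSub_map_J2 (key _ _))) (hH.hSub_map_J3 (key _ _)))

end IsHypercomplex

/-- In a 2-step nilpotent hypercomplex Lie algebra, the Obata curvature takes
values in `𝔥 = (𝔤¹ ∩ J₂𝔤¹) + (J₁𝔤¹ ∩ J₃𝔤¹)`; moreover `𝔥` is `J₁,J₂,J₃`-invariant and
`𝔥 ⊆ 𝔤₁^ℍ = 𝔤¹ + J₁𝔤¹ + J₂𝔤¹ + J₃𝔤¹`. -/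
theorem stmt_14 {L : Type*} [LieRing L] [LieAlgebra ℝ L] [FiniteDimensional ℝ L]
    (J1 J2 J3 : Module.End ℝ L) (hH : IsHypercomplex J1 J2 J3)
    (h2 : commIdeal L ≤ centerSub L) :
    (∀ X Y Z : L, obataCurv J1 J2 J3 X Y Z ∈ hSub J1 J2 J3) ∧
    ((hSub J1 J2 J3).map J1 ≤ hSub J1 J2 J3 ∧
     (hSub J1 J2 J3).map J2 ≤ hSub J1 J2 J3 ∧
     (hSub J1 J2 J3).map J3 ≤ hSub J1 J2 J3) ∧
    hSub J1 J2 J3 ≤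
      commIdeal L ⊔ (commIdeal L).map J1 ⊔ (commIdeal L).map J2 ⊔ (commIdeal L).map J3 := by
  refine ⟨fun X Y Z => ?_, ⟨?_, ?_, ?_⟩, ?_⟩
  · have hXY : ⁅X, Y⁆ ∈ centerSub L := h2 (IsHypercomplex.lie_mem_commIdeal X Y)
    have e : obata J1 J2 J3 ⁅X, Y⁆ Z = obata J1 J2 J3 Z ⁅X, Y⁆ := by
      rw [← sub_eq_zero, hH.obata_sub_obata, hXY Z]
    rw [obataCurv, e]
    exact sub_mem (sub_mem (hH.obata_obata_mem_hSub h2 X Y Z) (hH.obata_obata_mem_hSub h2 Y X Z))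
      (hH.obata_mem_hSub_of_mem_center Z hXY)
  · rintro _ ⟨x, hx, rfl⟩
    exact hH.hSub_map_J1 hx
  · rintro _ ⟨x, hx, rfl⟩
    exact hH.hSub_map_J2 hx
  · rintro _ ⟨x, hx, rfl⟩
    exact hH.hSub_map_J3 hx
  · exact sup_le (inf_le_left.trans (le_sup_left.trans (le_sup_left.trans le_sup_left)))
      (inf_le_left.trans (le_sup_right.trans (le_sup_left.trans le_sup_left)))
end
end

section
/- Let (𝔤, J₁, J₂, J₃) be a 2-step nilpotent hypercomplex real Lie algebra and set 𝔥 = (𝔤¹ ∩ J₂𝔤¹) + (J₁𝔤¹ ∩ J₃𝔤¹). Then every element of 𝔥 is parallel for the Obata connection: ∇_Y X = 0 for all Y ∈ 𝔤 and all X ∈ 𝔥. -/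
noncomputable section

/-- For a complex structure `J` and a central element `A`, the map `Y ↦ ⁅Y, J A⁆` is
`J`-linear. -/
theorem IsComplexStructure.lie_map_map_of_mem_centerSub {L : Type*} [LieRing L] [LieAlgebra ℝ L]
    {J : Module.End ℝ L} (hJ : IsComplexStructure J) {A : L} (hA : A ∈ centerSub L) (Y : L) :
    ⁅J Y, J A⁆ = J ⁅Y, J A⁆ := by
  have lie_zero_of_central (Z : L) : ⁅Z, A⁆ = 0 := by rw [← lie_skew, hA Z, neg_zero]
  have h := hJ.integrable Y A
  rw [nijenhuis, lie_zero_of_central, lie_zero_of_central, zero_add, zero_add] at h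
  exact (sub_eq_zero.mp h).symm

/-- If `X` and `J₂ X` are central then `X` is parallel for the Obata connection. -/
theorem obata_eq_zero_of_mem_centerSub {L : Type*} [LieRing L] [LieAlgebra ℝ L]
    (J1 J2 J3 : Module.End ℝ L) {X : L} (hX : X ∈ centerSub L) (hJX : J2 X ∈ centerSub L)
    (Y : L) : obata J1 J2 J3 Y X = 0 := by
  have hl (Z : L) : ⁅Z, X⁆ = 0 := by rw [← lie_skew, hX Z, neg_zero]
  have hr (Z : L) : ⁅Z, J2 X⁆ = 0 := by rw [← lie_skew, hJX Z, neg_zero]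
  simp [obata, hl, hr]

/-- If `X = J₁ A = J₃ B` with `A` and `B` central then `X` is parallel for the Obata
connection. -/
theorem IsHypercomplex.obata_eq_zero_of_map_eq_map {L : Type*} [LieRing L] [LieAlgebra ℝ L]
    {J1 J2 J3 : Module.End ℝ L} (hH : IsHypercomplex J1 J2 J3) {A B : L}
    (hA : A ∈ centerSub L) (hB : B ∈ centerSub L) (hAB : J3 B = J1 A) (Y : L) :
    obata J1 J2 J3 Y (J1 A) = 0 := by
  have q31 (Z : L) : J3 (J1 Z) = J2 Z := by
    rw [← hH.q12, hH.q21, map_neg, ← hH.q12, hH.c1.sq, neg_neg]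
  have q23 (Z : L) : J2 (J3 Z) = J1 Z := by
    rw [← hH.q12, hH.q21, ← hH.q12, hH.c2.sq, map_neg, neg_neg]
  have hJX : J2 (J1 A) = J1 B := by rw [← hAB, q23]
  rw [obata, hJX, hH.c1.lie_map_map_of_mem_centerSub hA, hH.c1.lie_map_map_of_mem_centerSub hB,
    hH.c1.sq, q31]
  rw [add_neg_cancel, zero_sub, neg_add_cancel, smul_zero]

/-- In a 2-step nilpotent hypercomplex Lie algebra, every element of
`𝔥 = (𝔤¹ ∩ J₂𝔤¹) + (J₁𝔤¹ ∩ J₃𝔤¹)` is parallel for the Obata connection: `∇_Y X = 0`. -/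
theorem stmt_16 {L : Type*} [LieRing L] [LieAlgebra ℝ L] [FiniteDimensional ℝ L]
    (J1 J2 J3 : Module.End ℝ L) (hH : IsHypercomplex J1 J2 J3)
    (h2 : commIdeal L ≤ centerSub L) :
    ∀ Y : L, ∀ X ∈ hSub J1 J2 J3, obata J1 J2 J3 Y X = 0 := by
  intro Y X hX
  obtain ⟨U, ⟨hU, V, hV, rfl⟩, W, ⟨⟨A, hA, rfl⟩, B, hB, hAB⟩, rfl⟩ := Submodule.mem_sup.mp hX
  have hadd (P Q : L) : obata J1 J2 J3 Y (P + Q) = obata J1 J2 J3 Y P + obata J1 J2 J3 Y Q := by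
    simp only [obata, map_add, lie_add, ← smul_add]
    congr 1
    abel
  have hJU : J2 (J2 V) ∈ centerSub L := by
    rw [hH.c2.sq]
    exact neg_mem (h2 hV)
  rw [hadd, obata_eq_zero_of_mem_centerSub J1 J2 J3 (h2 hU) hJU,
    hH.obata_eq_zero_of_map_eq_map (h2 hA) (h2 hB) hAB, add_zero]
end
end
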